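/- arXiv:2206.06478 — 3 statements merged into one kernel-verified Lean document; each statement's English description precedes it below -/
import Mathlib

section
/- For a finite simple graph G, the acyclic b-chromatic number satisfies A_b(G) = |V(G)| if and only if G is a complete graph. -/
open SimpleGraph

namespace AcyclicB

variable {V : Type*}

/-- `c` is a proper vertex coloring of `G`. -/
def Proper (G : SimpleGraph V) (c : V → ℕ) : Prop :=
  ∀ ⦃u v : V⦄, G.Adj u v → c u ≠ c v

/-- `c` is an acyclic (proper) coloring of `G`: the subgraph induced by the union of
any two color classes is a forest. -/
def IsAcyclicColoring (G : SimpleGraph V) (c : V → ℕ) : Prop :=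
  Proper G c ∧ ∀ i j : ℕ, (G.induce {v | c v = i ∨ c v = j}).IsAcyclic

/-- The closed neighborhood of `v` in `G`. -/
def closedNbhd (G : SimpleGraph V) (v : V) : Set V :=
  insert v (G.neighborSet v)

/-- `c'` is obtained from the acyclic coloring `c` by an acyclic recoloring step removing
one color `i`: every vertex of a color different from `i` keeps its color, and every vertex
of color `i` receives a color (among the colors of `c`, different from `i`) that is absent
from its closed neighborhood; the resulting coloring is again acyclic. -/
def RecolorStep (G : SimpleGraph V) (c' c : V → ℕ) : Prop :=
  IsAcyclicColoring G c ∧ IsAcyclicColoring G c' ∧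
  ∃ i ∈ Set.range c,
    (∀ v, c v ≠ i → c' v = c v) ∧
    (∀ v, c v = i → c' v ∈ Set.range c ∧ c' v ≠ i ∧
      ∀ u ∈ closedNbhd G v, c u ≠ c' v)

/-- The strict partial order `≺ₐ` on acyclic colorings: the transitive closure of the
acyclic recoloring step relation. -/
def StrictOrder (G : SimpleGraph V) : (V → ℕ) → (V → ℕ) → Prop :=
  Relation.TransGen (RecolorStep G)

/-- `c` is a minimal element of `≺ₐ`: an acyclic coloring admitting no acyclic recoloring
step. -/
def IsMinimal (G : SimpleGraph V) (c : V → ℕ) : Prop :=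
  IsAcyclicColoring G c ∧ ∀ c', ¬ RecolorStep G c' c

/-- The number of colors used by `c`. -/
def ncolors [Fintype V] (c : V → ℕ) : ℕ :=
  (Finset.univ.image c).card

/-- The acyclic b-chromatic number of `G`: the maximum number of colors used by a minimal
element of `≺ₐ`. -/
noncomputable def Ab [Fintype V] (G : SimpleGraph V) : ℕ :=
  sSup { k | ∃ c : V → ℕ, IsMinimal G c ∧ ncolors c = k }

/-- The acyclic chromatic number of `G`: the minimum number of colors in an acyclic
proper coloring. -/
noncomputable def Achrom [Fintype V] (G : SimpleGraph V) : ℕ :=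
  sInf { k | ∃ c : V → ℕ, IsAcyclicColoring G c ∧ ncolors c = k }

/-- The join of two graphs: disjoint copies of `G` and `H` together with all edges
between them. -/
def join {α β : Type*} (G : SimpleGraph α) (H : SimpleGraph β) : SimpleGraph (α ⊕ β) where
  Adj x y :=
    match x, y with
    | Sum.inl a, Sum.inl a' => G.Adj a a'
    | Sum.inr b, Sum.inr b' => H.Adj b b'
    | Sum.inl _, Sum.inr _ => True
    | Sum.inr _, Sum.inl _ => True
  symm := by
    refine ⟨?_⟩
    rintro (a | b) (a' | b') h
    · exact G.symm.symm _ _ h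
    · trivial
    · trivial
    · exact H.symm.symm _ _ h
  loopless := by
    refine ⟨?_⟩
    rintro (a | b) h
    · exact G.loopless.irrefl a h
    · exact H.loopless.irrefl b h

end AcyclicB

namespace AcyclicB

/-- A coloring whose only possible repetition is on a nonadjacent pair `u, v` is acyclic. -/
theorem isAcyclicColoring_of_eq_or_pair {V : Type*} {G : SimpleGraph V} {c : V → ℕ} {u v : V}
    (huv : ¬ G.Adj u v)
    (hc : ∀ x y, c x = c y → x = y ∨ (x = u ∧ y = v) ∨ (x = v ∧ y = u)) :
    IsAcyclicColoring G c := by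
  have hproper : Proper G c := by
    intro x y hxy h
    rcases hc x y h with rfl | ⟨rfl, rfl⟩ | ⟨rfl, rfl⟩
    · exact G.irrefl hxy
    · exact huv hxy
    · exact huv hxy.symm
  refine ⟨hproper, fun i j => ?_⟩
  have base_and_snd : ∀ x (p : (G.induce {w | c w = i ∨ c w = j}).Walk x x), p.IsCycle →
      (x : V) ≠ u ∧ (x : V) ≠ v ∧ ((p.snd : V) = u ∨ (p.snd : V) = v) := by
    intro x p hp
    have hy : G.Adj x p.snd := p.adj_snd hp.not_nil
    have hz : G.Adj x p.penultimate := (p.adj_penultimate hp.not_nil).symm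
    have hne : (p.snd : V) ≠ p.penultimate := fun h => hp.snd_ne_penultimate (Subtype.ext h)
    have hcol : c p.snd = c p.penultimate := by
      have h1 := hproper hy
      have h2 := hproper hz
      have h3 : c x = i ∨ c x = j := x.2
      have h4 : c p.snd = i ∨ c p.snd = j := p.snd.2
      have h5 : c p.penultimate = i ∨ c p.penultimate = j := p.penultimate.2
      omega
    have h6 := hy.ne
    have h7 := hz.ne
    rcases hc _ _ hcol with h | ⟨h, h'⟩ | ⟨h, h'⟩
    · exact absurd h hne
    · rw [h] at h6; rw [h'] at h7; exact ⟨h6, h7, Or.inl h⟩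
    · rw [h] at h6; rw [h'] at h7; exact ⟨h7, h6, Or.inr h⟩
  intro x p hp
  classical
  have hmem : p.snd ∈ p.support := p.getVert_mem_support 1
  obtain ⟨hu, hv, -⟩ := base_and_snd _ _ (hp.rotate hmem)
  exact (base_and_snd x p hp).2.2.elim hu hv

theorem isAcyclicColoring_of_injective {V : Type*} (G : SimpleGraph V) {c : V → ℕ}
    (hc : Function.Injective c) : IsAcyclicColoring G c := by
  refine ⟨fun x y hxy h => hxy.ne (hc h), fun i j x p => ?_⟩
  exact (isAcyclicColoring_of_eq_or_pair (G.irrefl (v := (x : V)))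
    fun y z h => Or.inl (hc h)).2 i j p

theorem ncolors_le_card {V : Type*} [Fintype V] (c : V → ℕ) : ncolors c ≤ Fintype.card V :=
  Finset.card_image_le

theorem ncolors_eq_card_iff {V : Type*} [Fintype V] (c : V → ℕ) :
    ncolors c = Fintype.card V ↔ Function.Injective c := by
  rw [ncolors, ← Finset.card_univ, Finset.card_image_iff, Finset.coe_univ, Set.injOn_univ]

/-- An injective coloring is minimal only on a complete graph. -/
theorem IsMinimal.eq_top_of_injective {V : Type*} {G : SimpleGraph V} {c : V → ℕ}
    (hmin : IsMinimal G c) (hc : Function.Injective c) : G = ⊤ := by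
  classical
  by_contra hG
  obtain ⟨u, v, hne, huv⟩ := SimpleGraph.ne_top_iff_exists_not_adj.mp hG
  refine hmin.2 (Function.update c u (c v)) ⟨hmin.1, ?_, c u, ⟨u, rfl⟩, ?_, ?_⟩
  · refine isAcyclicColoring_of_eq_or_pair huv fun x y h => ?_
    by_cases hx : x = u <;> by_cases hy : y = u
    · exact Or.inl (hx.trans hy.symm)
    · rw [hx, Function.update_self, Function.update_of_ne hy] at h
      exact Or.inr (Or.inl ⟨hx, (hc h).symm⟩)
    · rw [hy, Function.update_self, Function.update_of_ne hx] at h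
      exact Or.inr (Or.inr ⟨hc h, hy⟩)
    · rw [Function.update_of_ne hx, Function.update_of_ne hy] at h
      exact Or.inl (hc h)
  · exact fun w hw => Function.update_of_ne (fun h => hw (congrArg c h)) _ _
  · intro w hw
    obtain rfl := hc hw
    rw [Function.update_self]
    refine ⟨⟨v, rfl⟩, fun h => hne (hc h).symm, fun a ha h => ?_⟩
    obtain rfl := hc h
    exact ha.elim (fun h => hne h.symm) huv

/-- Every acyclic coloring of a complete graph is minimal. -/
theorem IsAcyclicColoring.isMinimal_top {V : Type*} {c : V → ℕ}
    (hc : IsAcyclicColoring (⊤ : SimpleGraph V) c) : IsMinimal ⊤ c := by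
  refine ⟨hc, ?_⟩
  rintro c' ⟨-, -, i, ⟨v, hv⟩, -, h⟩
  obtain ⟨⟨u, hu⟩, -, hn⟩ := h v hv
  exact hn u ((eq_or_ne u v).imp id fun h => h.symm) hu

/-- `A_b(G) = |V(G)|` if and only if `G` is a complete graph. -/
theorem ab_eq_card_iff_complete {V : Type*} [Fintype V] (G : SimpleGraph V) :
    Ab G = Fintype.card V ↔ G = ⊤ := by
  have hub : Fintype.card V ∈ upperBounds {k | ∃ c : V → ℕ, IsMinimal G c ∧ ncolors c = k} := by
    rintro k ⟨c, -, rfl⟩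
    exact ncolors_le_card c
  constructor
  · intro h
    rcases isEmpty_or_nonempty V with hV | hV
    · exact Subsingleton.elim _ _
    · have hpos : Ab G ≠ 0 := h ▸ Fintype.card_ne_zero
      have hne : {k | ∃ c : V → ℕ, IsMinimal G c ∧ ncolors c = k}.Nonempty := by
        rw [Set.nonempty_iff_ne_empty]
        intro h0
        exact hpos (by rw [Ab, h0, csSup_empty, Nat.bot_eq_zero])
      obtain ⟨c, hmin, hcard⟩ := Nat.sSup_mem hne ⟨_, hub⟩
      exact hmin.eq_top_of_injective ((ncolors_eq_card_iff c).mp (hcard.trans h))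
  · rintro rfl
    obtain ⟨c, hc⟩ := Countable.exists_injective_nat V
    exact IsGreatest.csSup_eq ⟨⟨c, (isAcyclicColoring_of_injective _ hc).isMinimal_top,
      (ncolors_eq_card_iff c).mpr hc⟩, hub⟩

end AcyclicB
end

section
/- For every finite simple graph G with maximum degree Δ(G) ≥ 2, the acyclic b-chromatic number satisfies A_b(G) ≤ (1/2)·Δ(G)² + 1. -/
open SimpleGraph

namespace AcyclicB

/-- Acyclicity of a coloring in terms of the cycles of `G`: none is bichromatic. -/
theorem isAcyclicColoring_iff_forall_isCycle {V : Type*} {G : SimpleGraph V} {c : V → ℕ} :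
    IsAcyclicColoring G c ↔ Proper G c ∧
      ∀ (i j : ℕ) (v : V) (p : G.Walk v v), p.IsCycle →
        ¬ ∀ x ∈ p.support, c x = i ∨ c x = j := by
  refine and_congr_right fun _ => forall₂_congr fun i j =>
    ⟨fun h v p hp hs => ?_, fun h v p hp => ?_⟩
  · refine h (p.induce {v | c v = i ∨ c v = j} hs) ?_
    refine (Walk.isCycle_map_iff_of_injective
      (f := (Embedding.induce (G := G) {v | c v = i ∨ c v = j}).toHom)
      (Embedding.induce (G := G) {v | c v = i ∨ c v = j}).injective).1 ?_
    exact (Walk.map_induce p hs).symm ▸ hp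
  · let f := (Embedding.induce (G := G) {v | c v = i ∨ c v = j}).toHom
    refine h v _ (hp.map (f := f) Subtype.val_injective) fun x hx => ?_
    obtain ⟨y, -, rfl⟩ := List.mem_map.1 ((congrArg (x ∈ ·) (Walk.support_map f p)).mp hx)
    exact y.2

/-- Recoloring one vertex `v` keeps the coloring acyclic as soon as the new color is absent from
the neighborhood of `v` and no two equally colored neighbors of `v` both see it away from `v`. -/
theorem IsAcyclicColoring.update {V : Type*} [DecidableEq V] {G : SimpleGraph V} {c : V → ℕ}
    (hc : IsAcyclicColoring G c) {v : V} {k : ℕ} (hk : ∀ u, G.Adj v u → c u ≠ k)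
    (hk' : ∀ u w x y, G.Adj v u → G.Adj v w → u ≠ w → c u = c w → G.Adj u x → x ≠ v →
      G.Adj w y → y ≠ v → c x = k → c y ≠ k) :
    IsAcyclicColoring G (Function.update c v k) := by
  rw [isAcyclicColoring_iff_forall_isCycle] at hc ⊢
  have hP : Proper G (Function.update c v k) := by
    intro a b hab
    rcases eq_or_ne a v with rfl | ha
    · simpa [hab.ne'] using (hk b hab).symm
    rcases eq_or_ne b v with rfl | hb
    · simpa [hab.ne] using hk a hab.symm
    · simpa [ha, hb] using hc.1 hab
  refine ⟨hP, fun i j z p hp hs => ?_⟩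
  by_cases hv : v ∈ p.support
  · have two {a : V} (ha : a ∈ p.support) (b : V) :
        ∃ d ∈ p.support, p.toSubgraph.Adj a d ∧ d ≠ b := by
      obtain ⟨d, hd, hdb⟩ := Set.exists_ne_of_one_lt_ncard
        (by rw [hp.ncard_neighborSet_toSubgraph_eq_two ha]; norm_num) b
      exact ⟨d, p.mem_verts_toSubgraph.1 hd.snd_mem, hd, hdb⟩
    obtain ⟨u, hu, hvu, -⟩ := two hv v
    obtain ⟨w, hw, hvw, hwu⟩ := two hv u
    obtain ⟨x, hx, hux, hxv⟩ := two hu v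
    obtain ⟨y, hy, hwy, hyv⟩ := two hw v
    have key : c u = c w ∧ c x = k ∧ c y = k := by
      have h1 := hP hvu.adj_sub
      have h2 := hP hvw.adj_sub
      have h3 := hP hux.adj_sub
      have h4 := hP hwy.adj_sub
      have h5 := hs v hv
      have h6 := hs u hu
      have h7 := hs w hw
      have h8 := hs x hx
      have h9 := hs y hy
      have hu' : u ≠ v := hvu.adj_sub.ne'
      have hw' : w ≠ v := hvw.adj_sub.ne'
      simp only [Function.update_self, Function.update_of_ne hu', Function.update_of_ne hw',
        Function.update_of_ne hxv, Function.update_of_ne hyv] at h1 h2 h3 h4 h5 h6 h7 h8 h9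
      omega
    exact hk' u w x y hvu.adj_sub hvw.adj_sub hwu.symm key.1 hux.adj_sub hxv hwy.adj_sub hyv
      key.2.1 key.2.2
  · refine hc.2 i j z p hp fun x hx => ?_
    have hxv : x ≠ v := by rintro rfl; exact hv hx
    simpa [hxv] using hs x hx

/-- A vertex of an acyclic coloring can be recolored from any palette of more than `Δ² / 2`
colors, keeping the coloring acyclic. -/
theorem IsAcyclicColoring.exists_update {V : Type*} [Fintype V] [DecidableEq V]
    {G : SimpleGraph V} [DecidableRel G.Adj] (hΔ : 2 ≤ G.maxDegree) {c : V → ℕ}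
    (hc : IsAcyclicColoring G c) (v : V) {P : Finset ℕ} (hP : G.maxDegree ^ 2 < 2 * P.card) :
    ∃ k ∈ P, (∀ u, G.Adj v u → c u ≠ k) ∧ IsAcyclicColoring G (Function.update c v k) := by
  classical
  set D := G.neighborFinset v
  let seen (u : V) : Finset ℕ := ((G.neighborFinset u).erase v).image c
  let cls (l : ℕ) : Finset V := D.filter (c · = l)
  let bad (l : ℕ) : Finset ℕ := P.filter fun k => 2 ≤ ((cls l).filter (k ∈ seen ·)).card
  have seen_card {u : V} (hu : u ∈ D) : (seen u).card ≤ G.maxDegree - 1 := by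
    refine Finset.card_image_le.trans ?_
    rw [Finset.card_erase_of_mem (by simpa [D, G.adj_comm] using hu)]
    exact Nat.sub_le_sub_right (G.degree_le_maxDegree u) 1
  have bad_card (l : ℕ) : 2 * (bad l).card ≤ (cls l).card * (G.maxDegree - 1) := by
    calc 2 * (bad l).card = ∑ k ∈ bad l, 2 := by simp [mul_comm]
      _ ≤ ∑ k ∈ bad l, ((cls l).filter (k ∈ seen ·)).card :=
        Finset.sum_le_sum fun k hk => (Finset.mem_filter.1 hk).2
      _ = ∑ u ∈ cls l, ((bad l).filter (· ∈ seen u)).card :=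
        Finset.sum_card_bipartiteAbove_eq_sum_card_bipartiteBelow fun k u => k ∈ seen u
      _ ≤ ∑ u ∈ cls l, (G.maxDegree - 1) := Finset.sum_le_sum fun u hu =>
        (Finset.card_le_card fun k hk => (Finset.mem_filter.1 hk).2).trans
          (seen_card (Finset.mem_filter.1 hu).1)
      _ = (cls l).card * (G.maxDegree - 1) := by simp
  have forbidden_card {l : ℕ} (hl : l ∈ D.image c) :
      2 * (insert l (bad l)).card ≤ (cls l).card * G.maxDegree := by
    have h1 := Finset.card_insert_le l (bad l)
    have hpos : 0 < (cls l).card := by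
      obtain ⟨u, hu, rfl⟩ := Finset.mem_image.1 hl
      exact Finset.card_pos.2 ⟨u, Finset.mem_filter.2 ⟨hu, rfl⟩⟩
    rcases Nat.lt_or_ge (cls l).card 2 with hlt | hge
    · have : bad l = ∅ := Finset.filter_eq_empty_iff.2 fun k _ hk =>
        absurd (hk.trans (Finset.card_filter_le _ _)) (by omega)
      have h2 : (cls l).card = 1 := by omega
      rw [this] at h1 ⊢
      simpa [h2] using hΔ
    · have h2 := bad_card l
      obtain ⟨n, hn⟩ : ∃ n, G.maxDegree = n + 1 := ⟨G.maxDegree - 1, by omega⟩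
      rw [hn] at h2 ⊢
      rw [Nat.add_sub_cancel] at h2
      rw [mul_add]
      omega
  have total : 2 * ((D.image c).biUnion fun l => insert l (bad l)).card ≤ G.maxDegree ^ 2 := by
    calc _ ≤ 2 * ∑ l ∈ D.image c, (insert l (bad l)).card :=
        Nat.mul_le_mul_left _ Finset.card_biUnion_le
      _ ≤ ∑ l ∈ D.image c, (cls l).card * G.maxDegree := by
        rw [Finset.mul_sum]
        exact Finset.sum_le_sum fun l hl => forbidden_card hl
      _ = D.card * G.maxDegree := by
        rw [← Finset.sum_mul, Finset.card_eq_sum_card_image c D]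
      _ ≤ G.maxDegree ^ 2 := by
        rw [sq]
        exact Nat.mul_le_mul_right _ (G.degree_le_maxDegree v)
  obtain ⟨k, hkP, hk⟩ := Finset.exists_mem_notMem_of_card_lt_card
    (show ((D.image c).biUnion fun l => insert l (bad l)).card < P.card by omega)
  simp only [Finset.mem_biUnion, Finset.mem_insert, not_exists, not_and, not_or] at hk
  have mem_D {u : V} (hu : G.Adj v u) : u ∈ D := (G.mem_neighborFinset v u).2 hu
  have hkN (u : V) (hu : G.Adj v u) : c u ≠ k :=
    (hk (c u) (Finset.mem_image_of_mem c (mem_D hu))).1 ∘ Eq.symm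
  refine ⟨k, hkP, hkN, hc.update hkN fun u w x y hu hw huw hcuw hux hxv hwy hyv hxk hyk => ?_⟩
  refine (hk (c u) (Finset.mem_image_of_mem c (mem_D hu))).2 (Finset.mem_filter.2 ⟨hkP, ?_⟩)
  refine Finset.one_lt_card.2 ⟨u, ?_, w, ?_, huw⟩
  · simp only [cls, seen, Finset.mem_filter, Finset.mem_image, Finset.mem_erase,
      mem_neighborFinset]
    exact ⟨⟨mem_D hu, trivial⟩, x, ⟨hxv, hux⟩, hxk⟩
  · simp only [cls, seen, Finset.mem_filter, Finset.mem_image, Finset.mem_erase,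
      mem_neighborFinset]
    exact ⟨⟨mem_D hw, hcuw.symm⟩, y, ⟨hyv, hwy⟩, hyk⟩

/-- An acyclic coloring with more than `Δ² / 2 + 1` colors admits an acyclic recoloring step. -/
theorem IsAcyclicColoring.exists_recolorStep {V : Type*} [Fintype V]
    {G : SimpleGraph V} [DecidableRel G.Adj] (hΔ : 2 ≤ G.maxDegree) {c : V → ℕ}
    (hc : IsAcyclicColoring G c) (hn : G.maxDegree ^ 2 + 2 < 2 * ncolors c) :
    ∃ c', RecolorStep G c' c := by
  classical
  obtain ⟨i, hi⟩ : (Finset.univ.image c).Nonempty :=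
    Finset.card_pos.1 (by unfold ncolors at hn; omega)
  have hP : G.maxDegree ^ 2 < 2 * ((Finset.univ.image c).erase i).card := by
    rw [Finset.card_erase_of_mem hi]
    unfold ncolors at hn
    omega
  have partial_recoloring (S : Finset V) : (∀ v ∈ S, c v = i) → ∃ c' : V → ℕ,
      IsAcyclicColoring G c' ∧ (∀ v ∉ S, c' v = c v) ∧
      ∀ v ∈ S, c' v ∈ (Finset.univ.image c).erase i ∧ ∀ u, G.Adj v u → c u ≠ c' v := by
    induction S using Finset.induction_on with
    | empty => exact fun _ => ⟨c, hc, by simp⟩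
    | insert v S hv ih =>
      intro hS
      obtain ⟨d, hd, hdS, hdS'⟩ := ih fun u hu => hS u (Finset.mem_insert_of_mem hu)
      obtain ⟨k, hk, hkN, hdk⟩ := hd.exists_update hΔ v hP
      refine ⟨_, hdk, fun u hu => ?_, fun u hu => ?_⟩
      · rw [Finset.mem_insert, not_or] at hu
        rw [Function.update_of_ne hu.1, hdS u hu.2]
      · rcases eq_or_ne u v with rfl | huv
        · rw [Function.update_self]
          refine ⟨hk, fun w hw => ?_⟩
          have hwS : w ∉ S := fun h => hc.1 hw <|
            (hS u hu).trans (hS w (Finset.mem_insert_of_mem h)).symm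
          rw [← hdS w hwS]
          exact hkN w hw
        · rw [Function.update_of_ne huv]
          exact hdS' u (Finset.mem_of_mem_insert_of_ne hu huv)
  obtain ⟨c', hc', h1, h2⟩ := partial_recoloring (Finset.univ.filter (c · = i)) (by simp)
  refine ⟨c', hc, hc', i, by simpa using hi, fun v hv => h1 v (by simpa using hv),
    fun v hv => ?_⟩
  obtain ⟨hmem, hN⟩ := h2 v (by simpa using hv)
  rw [Finset.mem_erase] at hmem
  refine ⟨by simpa using hmem.2, hmem.1, fun u hu => ?_⟩
  rcases hu with rfl | hu
  · rw [hv]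
    exact hmem.1.symm
  · exact hN u hu

/-- For every finite simple graph `G` with `Δ(G) ≥ 2`,
`A_b(G) ≤ (1/2)·Δ(G)² + 1`. -/
theorem ab_le_half_maxDegree_sq {V : Type*} [Fintype V] (G : SimpleGraph V)
    [DecidableRel G.Adj] (hΔ : 2 ≤ G.maxDegree) :
    (Ab G : ℝ) ≤ (G.maxDegree : ℝ) ^ 2 / 2 + 1 := by
  have h : Ab G ≤ (G.maxDegree ^ 2 + 2) / 2 := by
    refine csSup_le' ?_
    rintro _ ⟨c, hc, rfl⟩
    by_contra! hlt
    obtain ⟨c', hc'⟩ := hc.1.exists_recolorStep hΔ (by omega)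
    exact hc.2 c' hc'
  have h' : 2 * Ab G ≤ G.maxDegree ^ 2 + 2 := by omega
  have h'' : (2 * Ab G : ℝ) ≤ (G.maxDegree : ℝ) ^ 2 + 2 := by exact_mod_cast h'
  linarith

end AcyclicB
end

section
/- For every integer n ≥ 1 there exists a finite simple graph G with maximum degree Δ(G) = n+3 and acyclic b-chromatic number A_b(G) = 2n+4; in particular, A_b(G) − Δ(G) = n+1, so the acyclic b-chromatic number can exceed the maximum degree by an arbitrarily large amount. -/
open SimpleGraph

namespace AcyclicB

section Cycles

variable {V : Type*} {G : SimpleGraph V}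

/-- A proper coloring is acyclic iff every cycle meets at least three color classes. -/
theorem isAcyclicColoring_iff {c : V → ℕ} :
    IsAcyclicColoring G c ↔ Proper G c ∧
      ∀ (v : V) (p : G.Walk v v), p.IsCycle → ∀ a b : ℕ, ∃ w ∈ p.support, ¬(c w = a ∨ c w = b) := by
  refine and_congr_right fun _ => ⟨fun h v p hp a b => ?_, fun h a b v p hp => ?_⟩
  · by_contra! hcon
    have hs : ∀ w ∈ p.support, w ∈ {v | c v = a ∨ c v = b} := hcon
    refine h a b (p.induce _ hs) ?_
    rw [← Walk.isCycle_map_iff_of_injective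
      (f := (Embedding.induce {v | c v = a ∨ c v = b}).toHom) Subtype.val_injective]
    rwa [Walk.map_induce]
  · have hq := hp.map (f := (Embedding.induce (G := G) {v | c v = a ∨ c v = b}).toHom)
      Subtype.val_injective
    obtain ⟨w, hw, hn⟩ := h _ _ hq a b
    rw [Walk.support_map, List.mem_map] at hw
    obtain ⟨x, -, rfl⟩ := hw
    exact hn x.2

theorem exists_two_neighbors_of_isCycle {v w : V} {p : G.Walk v v} (hp : p.IsCycle)
    (hw : w ∈ p.support) :
    ∃ x ∈ p.support, ∃ y ∈ p.support, x ≠ y ∧ G.Adj w x ∧ G.Adj w y := by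
  have h := hp.ncard_neighborSet_toSubgraph_eq_two hw
  obtain ⟨x, y, hxy, hs⟩ := Set.ncard_eq_two.1 h
  have hx : p.toSubgraph.Adj w x := by
    rw [← Subgraph.mem_neighborSet, hs]; simp
  have hy : p.toSubgraph.Adj w y := by
    rw [← Subgraph.mem_neighborSet, hs]; simp
  exact ⟨x, (Walk.mem_verts_toSubgraph p).1 hx.snd_mem, y,
    (Walk.mem_verts_toSubgraph p).1 hy.snd_mem, hxy, hx.adj_sub, hy.adj_sub⟩

/-- If all repeated colors on a cycle coincide, then the cycle meets at least three color classes
of any proper coloring. -/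
theorem exists_third_color_of_repeated_eq {c : V → ℕ} (hc : Proper G c) {v : V} {p : G.Walk v v}
    (hp : p.IsCycle) (m : ℕ)
    (hm : ∀ x ∈ p.support, ∀ y ∈ p.support, x ≠ y → c x = c y → c x = m) (a b : ℕ) :
    ∃ w ∈ p.support, ¬(c w = a ∨ c w = b) := by
  by_contra! hcon
  have key : ∀ w ∈ p.support, ∃ x ∈ p.support, G.Adj w x ∧ c x = m := by
    intro w hw
    obtain ⟨x, hx, y, hy, hxy, hwx, hwy⟩ := exists_two_neighbors_of_isCycle hp hw
    refine ⟨x, hx, hwx, hm x hx y hy hxy ?_⟩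
    have := hcon w hw
    have := hcon x hx
    have := hcon y hy
    have := hc hwx
    have := hc hwy
    grind
  obtain ⟨x, hx, -, hxm⟩ := key v p.start_mem_support
  obtain ⟨y, -, hxy, hym⟩ := key x hx
  exact hc hxy (hxm.trans hym.symm)

end Cycles

section Copies

variable {ι W : Type*}

/-- The disjoint union of copies of `H` indexed by `ι`. -/
def copies (ι : Type*) (H : SimpleGraph W) : SimpleGraph (ι × W) where
  Adj p q := p.1 = q.1 ∧ H.Adj p.2 q.2
  symm := ⟨fun _ _ h => ⟨h.1.symm, h.2.symm⟩⟩
  loopless := ⟨fun _ h => H.irrefl h.2⟩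

@[simp]
theorem copies_adj {H : SimpleGraph W} {p q : ι × W} :
    (copies ι H).Adj p q ↔ p.1 = q.1 ∧ H.Adj p.2 q.2 := Iff.rfl

theorem fst_eq_of_mem_support {H : SimpleGraph W} {u v w : ι × W} (p : (copies ι H).Walk u v)
    (hw : w ∈ p.support) : w.1 = u.1 := by
  induction p with
  | nil => simp_all
  | cons h p ih =>
    rw [Walk.support_cons, List.mem_cons] at hw
    rcases hw with rfl | hw
    · rfl
    · exact (ih hw).trans h.1.symm

theorem isAcyclicColoring_copies_of_repeated_eq {H : SimpleGraph W} {c : ι × W → ℕ}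
    (hc : Proper (copies ι H) c) (m : ι → ℕ)
    (hm : ∀ t x y, x ≠ y → c (t, x) = c (t, y) → c (t, x) = m t) :
    IsAcyclicColoring (copies ι H) c := by
  refine isAcyclicColoring_iff.2 ⟨hc, fun v p hp => ?_⟩
  refine exists_third_color_of_repeated_eq hc hp (m v.1) ?_
  rintro ⟨s, x⟩ hx ⟨t, y⟩ hy hxy h
  obtain rfl : s = v.1 := fst_eq_of_mem_support p hx
  obtain rfl : t = v.1 := fst_eq_of_mem_support p hy
  exact hm _ x y (by rintro rfl; exact hxy rfl) h

/-- In each copy the color `i` can be eliminated: it is absent, or some other color is absent, or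
all colors appear exactly once and two nonadjacent vertices can be merged. -/
theorem exists_replacement_color [Fintype ι] [Fintype W] {H : SimpleGraph W} {c : ι × W → ℕ}
    (hH : ∀ w, ∃ q, q ≠ w ∧ ¬ H.Adj w q) (hW : 2 ≤ Fintype.card W)
    (hk : Fintype.card W ≤ ncolors c) (i : ℕ) (t : ι) :
    ∃ j ∈ Set.range c, j ≠ i ∧ ((∀ w, c (t, w) ≠ i) ∨ (∀ w, c (t, w) ≠ j) ∨
      (Function.Injective (fun w => c (t, w)) ∧
        ∃ w q, c (t, w) = i ∧ c (t, q) = j ∧ ¬ H.Adj w q)) := by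
  by_cases hi : ∀ w, c (t, w) ≠ i
  · have h1 : 1 < (Finset.univ.image c).card := lt_of_lt_of_le hW hk
    obtain ⟨j, hj, hji⟩ := Finset.exists_mem_ne h1 i
    exact ⟨j, by simpa using hj, hji, Or.inl hi⟩
  by_cases hj : ∃ j ∈ Set.range c, ∀ w, c (t, w) ≠ j
  · obtain ⟨j, hjr, hj⟩ := hj
    refine ⟨j, hjr, ?_, Or.inr (Or.inl hj)⟩
    rintro rfl
    exact hi hj
  push Not at hi hj
  have hsub : Finset.univ.image c ⊆ Finset.univ.image (fun w => c (t, w)) := by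
    intro x hx
    simpa using hj x (by simpa using hx)
  have hinj : Function.Injective (fun w => c (t, w)) := by
    rw [← Set.injOn_univ, ← Finset.coe_univ, ← Finset.card_image_iff]
    exact le_antisymm Finset.card_image_le (hk.trans (Finset.card_le_card hsub))
  obtain ⟨w, hw⟩ := hi
  obtain ⟨q, hqw, hq⟩ := hH w
  refine ⟨c (t, q), ⟨_, rfl⟩, ?_, Or.inr (Or.inr ⟨hinj, w, q, hw, rfl, hq⟩)⟩
  rw [← hw]
  exact fun h => hqw (hinj h)

theorem not_isMinimal_copies [Fintype ι] [Nonempty ι] [Fintype W] {H : SimpleGraph W}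
    {c : ι × W → ℕ} (hH : ∀ w, ∃ q, q ≠ w ∧ ¬ H.Adj w q) (hW : 2 ≤ Fintype.card W)
    (hk : Fintype.card W ≤ ncolors c) : ¬ IsMinimal (copies ι H) c := by
  rintro ⟨hc, hmin⟩
  obtain ⟨w₀⟩ : Nonempty W := Fintype.card_pos_iff.1 (by omega)
  obtain ⟨t₀⟩ : Nonempty ι := inferInstance
  set i := c (t₀, w₀) with hi
  choose j hjr hji hj using exists_replacement_color hH hW hk i
  obtain ⟨hcp, hcc⟩ := isAcyclicColoring_iff.1 hc
  have havoid : ∀ t w q, c (t, w) = i → H.Adj w q → c (t, q) ≠ j t := by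
    intro t w q hw hwq hq
    rcases hj t with h | h | ⟨hinj, w', q', hw', hq', hn⟩
    · exact h w hw
    · exact h q hq
    · obtain rfl : w = w' := hinj (hw.trans hw'.symm)
      obtain rfl : q = q' := hinj (hq.trans hq'.symm)
      exact hn hwq
  set c' : ι × W → ℕ := fun v => if c v = i then j v.1 else c v with hc'
  have hproper : Proper (copies ι H) c' := by
    rintro ⟨s, x⟩ ⟨t, y⟩ h
    obtain ⟨hst, hxy⟩ := copies_adj.1 h
    obtain rfl : s = t := hst
    have h1 := hcp h
    have h2 := havoid s x y
    have h3 := havoid s y x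
    have := hxy.symm
    simp only [hc']
    grind
  refine hmin c' ⟨hc, isAcyclicColoring_iff.2 ⟨hproper, fun v p hp a b => ?_⟩, i, ⟨_, hi.symm⟩,
    fun v hv => if_neg hv, fun v hv => ?_⟩
  · have hfst : ∀ w ∈ p.support, w = (v.1, w.2) := fun w hw =>
      Prod.ext (show w.1 = v.1 from fst_eq_of_mem_support p hw) rfl
    rcases hj v.1 with h | h | ⟨hinj, w', q', hw', hq', hn⟩
    · obtain ⟨w, hw, hab⟩ := hcc v p hp a b
      refine ⟨w, hw, ?_⟩
      have : c w ≠ i := by rw [hfst w hw]; exact h _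
      simpa only [hc', if_neg this] using hab
    · obtain ⟨w, hw, hab⟩ := hcc v p hp (if a = j v.1 then i else a) (if b = j v.1 then i else b)
      refine ⟨w, hw, ?_⟩
      have h1 : c w ≠ j v.1 := by rw [hfst w hw]; exact h _
      have h2 : w.1 = v.1 := fst_eq_of_mem_support p hw
      simp only [hc', h2]
      grind
    · refine exists_third_color_of_repeated_eq hproper hp (j v.1) ?_ a b
      intro x hx y hy hxy h
      have hx1 : x.1 = v.1 := fst_eq_of_mem_support p hx
      have hy1 : y.1 = v.1 := fst_eq_of_mem_support p hy
      have hne : c x ≠ c y := by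
        rw [hfst x hx, hfst y hy]
        intro h
        have h2 : x.2 = y.2 := hinj h
        exact hxy (Prod.ext (hx1.trans hy1.symm) h2)
      simp only [hc', hx1, hy1] at h ⊢
      grind
  · have hv' : c' v = j v.1 := if_pos hv
    rw [hv']
    refine ⟨hjr _, hji _, ?_⟩
    rintro ⟨t, u⟩ hu
    rcases hu with rfl | hu
    · rw [hv]; exact (hji _).symm
    · obtain ⟨h1, h2⟩ := copies_adj.1 hu
      obtain rfl : v.1 = t := h1
      exact havoid v.1 v.2 u hv h2

end Copies

section Gadget

/-- The graph consisting of `K_{2,n+2}` with `n + 1` leaves attached to a vertex of the larger side.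
The smaller side is `{1, 2n+4}`, the larger side is `{0} ∪ [2, n+2]`, and the leaves
`[n+3, 2n+3]` hang at `0`. -/
def gadget (n : ℕ) : SimpleGraph (Fin (2 * n + 5)) :=
  SimpleGraph.fromRel fun p q =>
    ((p.val = 1 ∨ p.val = 2 * n + 4) ∧ (q.val = 0 ∨ 2 ≤ q.val ∧ q.val ≤ n + 2)) ∨
      (p.val = 0 ∧ n + 3 ≤ q.val ∧ q.val ≤ 2 * n + 3)

theorem gadget_adj {n : ℕ} {p q : Fin (2 * n + 5)} :
    (gadget n).Adj p q ↔
      ((p.val = 1 ∨ p.val = 2 * n + 4) ∧ (q.val = 0 ∨ 2 ≤ q.val ∧ q.val ≤ n + 2)) ∨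
      (p.val = 0 ∧ n + 3 ≤ q.val ∧ q.val ≤ 2 * n + 3) ∨
      ((q.val = 1 ∨ q.val = 2 * n + 4) ∧ (p.val = 0 ∨ 2 ≤ p.val ∧ p.val ≤ n + 2)) ∨
      (q.val = 0 ∧ n + 3 ≤ p.val ∧ p.val ≤ 2 * n + 3) := by
  rw [gadget, SimpleGraph.fromRel_adj, ne_eq, Fin.ext_iff]
  omega

theorem gadget_exists_not_adj {n : ℕ} (w : Fin (2 * n + 5)) :
    ∃ q, q ≠ w ∧ ¬ (gadget n).Adj w q := by
  simp only [gadget_adj, ne_eq, Fin.ext_iff]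
  by_cases h1 : w.val = 1 ∨ w.val = 2 * n + 4
  · exact ⟨⟨2 * n + 3, by omega⟩, by simp only; omega⟩
  by_cases h2 : w.val = 2
  · exact ⟨⟨3, by omega⟩, by simp only; omega⟩
  · exact ⟨⟨2, by omega⟩, by simp only; omega⟩

variable {n : ℕ}

/-- The coloring of the copies of the gadget in which the two vertices `1` and `2n+4` share a color,
and the vertex `0` of copy `t` receives color `t`. -/
def gadgetColoring (n : ℕ) (v : Fin (2 * n + 4) × Fin (2 * n + 5)) : ℕ :=
  Equiv.swap 0 v.1.val (if v.2.val = 2 * n + 4 then 1 else v.2.val)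

theorem gadgetColoring_zero (t : Fin (2 * n + 4)) : gadgetColoring n (t, 0) = t := by
  simp [gadgetColoring]

theorem gadgetColoring_eq_iff {t : Fin (2 * n + 4)} {x y : Fin (2 * n + 5)} :
    gadgetColoring n (t, x) = gadgetColoring n (t, y) ↔
      x = y ∨ ((x.val = 1 ∨ x.val = 2 * n + 4) ∧ (y.val = 1 ∨ y.val = 2 * n + 4)) := by
  simp only [gadgetColoring, EmbeddingLike.apply_eq_iff_eq, Fin.ext_iff]
  grind

theorem range_gadgetColoring_copy (t : Fin (2 * n + 4)) :
    Set.range (fun w => gadgetColoring n (t, w)) = Set.Iio (2 * n + 4) := by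
  ext k
  simp only [Set.mem_range, Set.mem_Iio, gadgetColoring]
  constructor
  · rintro ⟨w, rfl⟩
    rw [Equiv.swap_apply_def]
    grind
  · intro hk
    have hlt : Equiv.swap 0 t.val k < 2 * n + 4 := by
      rw [Equiv.swap_apply_def]
      grind
    refine ⟨⟨Equiv.swap 0 t.val k, by omega⟩, ?_⟩
    simp [hlt.ne]

theorem range_gadgetColoring : Set.range (gadgetColoring n) = Set.Iio (2 * n + 4) := by
  ext k
  constructor
  · rintro ⟨⟨t, w⟩, rfl⟩
    rw [← range_gadgetColoring_copy t]
    exact ⟨w, rfl⟩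
  · intro hk
    rw [← range_gadgetColoring_copy 0] at hk
    obtain ⟨w, rfl⟩ := hk
    exact ⟨_, rfl⟩

theorem ncolors_gadgetColoring : ncolors (gadgetColoring n) = 2 * n + 4 := by
  rw [ncolors, ← Set.ncard_coe_finset, Finset.coe_image, Finset.coe_univ, Set.image_univ,
    range_gadgetColoring, ← Finset.coe_Iio, Set.ncard_coe_finset, Nat.card_Iio]

theorem isAcyclicColoring_gadgetColoring :
    IsAcyclicColoring (copies (Fin (2 * n + 4)) (gadget n)) (gadgetColoring n) := by
  refine isAcyclicColoring_copies_of_repeated_eq ?_ (fun t => gadgetColoring n (t, 1)) ?_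
  · rintro ⟨s, x⟩ ⟨t, y⟩ h
    obtain ⟨hst, hxy⟩ := copies_adj.1 h
    obtain rfl : s = t := hst
    have hne := hxy.ne
    dsimp only at hxy hne
    rw [gadget_adj] at hxy
    rw [ne_eq, gadgetColoring_eq_iff]
    omega
  · intro t x y hxy h
    rw [gadgetColoring_eq_iff] at h
    rw [gadgetColoring_eq_iff]
    have : (1 : Fin (2 * n + 5)).val = 1 := rfl
    tauto

theorem not_isAcyclicColoring_of_four_cycle {V : Type*} {G : SimpleGraph V} {c : V → ℕ}
    {x u y v : V} (hxu : G.Adj x u) (huy : G.Adj u y) (hyv : G.Adj y v) (hvx : G.Adj v x)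
    (hxy : x ≠ y) (huv : u ≠ v) (hcxy : c x = c y) (hcuv : c u = c v) :
    ¬ IsAcyclicColoring G c := by
  intro h
  have hp : (Walk.cons hxu (.cons huy (.cons hyv (.cons hvx .nil)))).IsCycle := by
    have := hxu.ne
    have := huy.ne
    have := hyv.ne
    have := hvx.ne
    simp only [Walk.isCycle_def, Walk.isTrail_def, Walk.edges_cons, Walk.edges_nil,
      Walk.support_cons, Walk.support_nil]
    simp
    grind
  obtain ⟨w, hw, hn⟩ := (isAcyclicColoring_iff.1 h).2 _ _ hp (c x) (c u)
  simp only [Walk.support_cons, Walk.support_nil, List.mem_cons] at hw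
  grind

theorem isMinimal_gadgetColoring :
    IsMinimal (copies (Fin (2 * n + 4)) (gadget n)) (gadgetColoring n) := by
  refine ⟨isAcyclicColoring_gadgetColoring, ?_⟩
  rintro c' ⟨-, hc', i, hi, hkeep, hnew⟩
  have hilt : i < 2 * n + 4 := by rwa [range_gadgetColoring] at hi
  let t : Fin (2 * n + 4) := ⟨i, hilt⟩
  have h0 : gadgetColoring n (t, 0) = i := gadgetColoring_zero t
  obtain ⟨hr, hne, hnb⟩ := hnew (t, 0) h0
  rw [range_gadgetColoring, ← range_gadgetColoring_copy t] at hr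
  obtain ⟨w, hw⟩ := hr
  dsimp only at hw
  have hw0 : w ≠ 0 := by
    rintro rfl
    exact hne (hw.symm.trans h0)
  have hnadj : ¬ (gadget n).Adj 0 w := fun h =>
    hnb (t, w) (Set.mem_insert_of_mem _ (copies_adj.2 ⟨rfl, h⟩)) hw
  have hwc : gadgetColoring n (t, w) ≠ i := by rwa [hw]
  have hz : (0 : Fin (2 * n + 5)).val = 0 := rfl
  have hone : (1 : Fin (2 * n + 5)).val = 1 := rfl
  have hw2 : 2 ≤ w.val ∧ w.val ≤ n + 2 := by
    rw [gadget_adj] at hnadj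
    rw [ne_eq, Fin.ext_iff] at hw0
    omega
  let z : Fin (2 * n + 5) := ⟨2 * n + 4, by omega⟩
  have hzv : z.val = 2 * n + 4 := rfl
  have hc1z : gadgetColoring n (t, 1) = gadgetColoring n (t, z) := by
    rw [gadgetColoring_eq_iff]; omega
  have hc1 : gadgetColoring n (t, 1) ≠ i := by
    rw [← h0, ne_eq, gadgetColoring_eq_iff, Fin.ext_iff]; omega
  refine not_isAcyclicColoring_of_four_cycle (c := c') (x := (t, 0)) (u := (t, 1)) (y := (t, w))
    (v := (t, z)) ?_ ?_ ?_ ?_ ?_ ?_ ?_ ?_ hc'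
  iterate 4 exact copies_adj.2 ⟨rfl, by rw [gadget_adj]; dsimp only; omega⟩
  · simpa using hw0.symm
  · rw [ne_eq, Prod.mk.injEq, Fin.ext_iff (a := 1)]; omega
  · rw [hkeep _ hwc, hw]
  · rw [hkeep _ hc1, hkeep _ (hc1z ▸ hc1), hc1z]

theorem Ab_copies_gadget : Ab (copies (Fin (2 * n + 4)) (gadget n)) = 2 * n + 4 := by
  refine IsGreatest.csSup_eq ⟨⟨_, isMinimal_gadgetColoring, ncolors_gadgetColoring⟩, ?_⟩
  rintro k ⟨c, hc, rfl⟩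
  by_contra! h
  refine not_isMinimal_copies gadget_exists_not_adj ?_ ?_ hc
  · simp
  · rw [Fintype.card_fin]; exact h

theorem maxDegree_copies_gadget [DecidableRel (copies (Fin (2 * n + 4)) (gadget n)).Adj] :
    (copies (Fin (2 * n + 4)) (gadget n)).maxDegree = n + 3 := by
  have hdeg : ∀ v, (copies (Fin (2 * n + 4)) (gadget n)).degree v =
      ((Finset.range (2 * n + 5)).filter fun q =>
        ((v.2.val = 1 ∨ v.2.val = 2 * n + 4) ∧ (q = 0 ∨ 2 ≤ q ∧ q ≤ n + 2)) ∨
        (v.2.val = 0 ∧ n + 3 ≤ q ∧ q ≤ 2 * n + 3) ∨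
        ((q = 1 ∨ q = 2 * n + 4) ∧ (v.2.val = 0 ∨ 2 ≤ v.2.val ∧ v.2.val ≤ n + 2)) ∨
        (q = 0 ∧ n + 3 ≤ v.2.val ∧ v.2.val ≤ 2 * n + 3)).card := by
    intro v
    rw [← SimpleGraph.card_neighborFinset_eq_degree]
    refine Finset.card_bij (fun x _ => x.2.val) ?_ ?_ ?_
    · intro x hx
      rw [SimpleGraph.mem_neighborFinset, copies_adj, gadget_adj] at hx
      rw [Finset.mem_filter, Finset.mem_range]
      exact ⟨x.2.isLt, hx.2⟩
    · intro x hx y hy h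
      rw [SimpleGraph.mem_neighborFinset, copies_adj] at hx hy
      exact Prod.ext (hx.1.symm.trans hy.1) (Fin.ext h)
    · intro q hq
      rw [Finset.mem_filter, Finset.mem_range] at hq
      refine ⟨(v.1, ⟨q, hq.1⟩), ?_, rfl⟩
      rw [SimpleGraph.mem_neighborFinset, copies_adj, gadget_adj]
      exact ⟨rfl, hq.2⟩
  have hcard : (insert 1 (Finset.Icc (n + 3) (2 * n + 4))).card = n + 3 := by
    rw [Finset.card_insert_of_notMem (by simp), Nat.card_Icc]
    omega
  apply le_antisymm
  · refine SimpleGraph.maxDegree_le_of_forall_degree_le _ _ fun v => ?_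
    rw [hdeg]
    by_cases h0 : v.2.val = 0
    · rw [← hcard]
      refine Finset.card_le_card fun q hq => ?_
      simp only [Finset.mem_filter, Finset.mem_range, Finset.mem_insert, Finset.mem_Icc] at hq ⊢
      omega
    by_cases h1 : v.2.val = 1 ∨ v.2.val = 2 * n + 4
    · calc _ ≤ (Finset.range (n + 3)).card := Finset.card_le_card fun q hq => by
            simp only [Finset.mem_filter, Finset.mem_range] at hq ⊢
            omega
        _ = n + 3 := Finset.card_range _
    · calc _ ≤ ({0, 1, 2 * n + 4} : Finset ℕ).card := Finset.card_le_card fun q hq => by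
            simp only [Finset.mem_filter, Finset.mem_range, Finset.mem_insert,
              Finset.mem_singleton] at hq ⊢
            omega
        _ ≤ 3 := Finset.card_le_three
        _ ≤ n + 3 := by omega
  · refine le_trans ?_ (SimpleGraph.degree_le_maxDegree _ (0, 0))
    rw [hdeg, ← hcard]
    refine Finset.card_le_card fun q hq => ?_
    rw [Finset.mem_insert, Finset.mem_Icc] at hq
    simp only [Finset.mem_filter, Finset.mem_range, Fin.val_zero, true_and, true_or, and_true]
    omega

end Gadget

/-- For every `n ≥ 1` there is a finite simple graph `G` with `Δ(G) = n + 3` and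
`A_b(G) = 2n + 4`; in particular `A_b(G) − Δ(G) = n + 1`, so the acyclic b-chromatic
number can exceed the maximum degree by an arbitrarily large amount. -/
theorem exists_ab_sub_maxDegree (n : ℕ) (hn : 1 ≤ n) :
    ∃ (V : Type) (_ : Fintype V) (G : SimpleGraph V) (_ : DecidableRel G.Adj),
      G.maxDegree = n + 3 ∧ Ab G = 2 * n + 4 ∧ Ab G - G.maxDegree = n + 1 := by
  classical
  refine ⟨Fin (2 * n + 4) × Fin (2 * n + 5), inferInstance,
    copies (Fin (2 * n + 4)) (gadget n), inferInstance, ?_⟩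
  rw [maxDegree_copies_gadget, Ab_copies_gadget]
  omega

end AcyclicB
end
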